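/- arXiv:2505.06570 — 7 statements merged into one kernel-verified Lean document; each statement's English description precedes it below -/
import Mathlib

section
/- Let H be a real Hilbert space, μ > 0, L > 0, and let T : ℝ → H → H be a time-dependent operator such that for every time t, the map T t is μ-strongly monotone and L-Lipschitz. Suppose ζ* ∈ H satisfies T t ζ* = 0 for all t. Let (γ_n) be a sequence of step sizes with 0 < γ_n ≤ 2μ/L² for all n, ∑ γ_n = ∞ and ∑ γ_n² < ∞, let (t_n) be any sequence of times, and define the iterates by ζ_{n+1} = ζ_n − γ_n · T t_n ζ_n from an arbitrary ζ_0 ∈ H. Then ζ_n converges (in norm) to ζ* as n → ∞. -/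
open RealInnerProductSpace Filter

/-- A discrete Grönwall inequality with variable growth rate. -/
lemma le_mul_exp_sum_of_succ_le {a c : ℕ → ℝ} (ha : ∀ n, 0 ≤ a n)
    (hstep : ∀ n, a (n + 1) ≤ (1 + c n) * a n) (N : ℕ) :
    a N ≤ a 0 * Real.exp (∑ n ∈ Finset.range N, c n) := by
  induction N with
  | zero => simp
  | succ N ih =>
    calc a (N + 1) ≤ (1 + c N) * a N := hstep N
      _ ≤ Real.exp (c N) * a N :=
        mul_le_mul_of_nonneg_right (by linarith [Real.add_one_le_exp (c N)]) (ha N)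
      _ ≤ Real.exp (c N) * (a 0 * Real.exp (∑ n ∈ Finset.range N, c n)) :=
        mul_le_mul_of_nonneg_left ih (Real.exp_pos _).le
      _ = a 0 * Real.exp (∑ n ∈ Finset.range (N + 1), c n) := by
        rw [Finset.sum_range_succ, Real.exp_add]
        ring

lemma tendsto_zero_of_succ_le_of_sum_tendsto_atBot {a c : ℕ → ℝ} (ha : ∀ n, 0 ≤ a n)
    (hstep : ∀ n, a (n + 1) ≤ (1 + c n) * a n)
    (hc : Tendsto (fun N => ∑ n ∈ Finset.range N, c n) atTop atBot) :
    Tendsto a atTop (nhds 0) := by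
  refine squeeze_zero ha (le_mul_exp_sum_of_succ_le ha hstep) ?_
  simpa using (Real.tendsto_exp_atBot.comp hc).const_mul (a 0)

/-- One forward step shrinks the squared distance to a zero of the operator. -/
lemma norm_sub_smul_sq_le {H : Type*} [NormedAddCommGroup H] [InnerProductSpace ℝ H]
    {μ L γ : ℝ} (hγ : 0 ≤ γ) {u v : H}
    (hmono : μ * ‖u‖ ^ 2 ≤ ⟪v, u⟫) (hlip : ‖v‖ ≤ L * ‖u‖) :
    ‖u - γ • v‖ ^ 2 ≤ (1 + (L ^ 2 * γ ^ 2 - 2 * μ * γ)) * ‖u‖ ^ 2 := by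
  have hv : ‖v‖ ^ 2 ≤ (L * ‖u‖) ^ 2 := pow_le_pow_left₀ (norm_nonneg v) hlip 2
  rw [norm_sub_sq_real, real_inner_smul_right, real_inner_comm, norm_smul, mul_pow,
    Real.norm_eq_abs, sq_abs]
  nlinarith [mul_le_mul_of_nonneg_left hmono hγ, mul_le_mul_of_nonneg_left hv (sq_nonneg γ)]

/-- Strong convergence of the explicit forward iteration for a dynamic,
strongly monotone, Lipschitz operator (Algorithm 1, strong convergence). -/
theorem dynamic_svi_strong_convergence
    {H : Type*} [NormedAddCommGroup H] [InnerProductSpace ℝ H] [CompleteSpace H]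
    (μ L : ℝ) (hμ : 0 < μ) (hL : 0 < L)
    (T : ℝ → H → H)
    (hmono : ∀ t : ℝ, ∀ x y : H, μ * ‖x - y‖ ^ 2 ≤ ⟪T t x - T t y, x - y⟫)
    (hlip : ∀ t : ℝ, ∀ x y : H, ‖T t x - T t y‖ ≤ L * ‖x - y‖)
    (ζstar : H) (hzero : ∀ t : ℝ, T t ζstar = 0)
    (γ : ℕ → ℝ) (hγpos : ∀ n, 0 < γ n) (hγle : ∀ n, γ n ≤ 2 * μ / L ^ 2)
    (hγdiv : Tendsto (fun N => ∑ n ∈ Finset.range N, γ n) atTop atTop)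
    (hγsq : Summable (fun n => (γ n) ^ 2))
    (t : ℕ → ℝ) (ζ : ℕ → H)
    (hrec : ∀ n, ζ (n + 1) = ζ n - γ n • T (t n) (ζ n)) :
    Tendsto ζ atTop (nhds ζstar) := by
  have hstep : ∀ n, ‖ζ (n + 1) - ζstar‖ ^ 2 ≤
      (1 + (L ^ 2 * γ n ^ 2 - 2 * μ * γ n)) * ‖ζ n - ζstar‖ ^ 2 := fun n => by
    have hm := hmono (t n) (ζ n) ζstar
    have hl := hlip (t n) (ζ n) ζstar
    rw [hzero, sub_zero] at hm hl
    rw [hrec, sub_right_comm]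
    exact norm_sub_smul_sq_le (hγpos n).le hm hl
  have hsum : Tendsto (fun N => ∑ n ∈ Finset.range N, (L ^ 2 * γ n ^ 2 - 2 * μ * γ n))
      atTop atBot := by
    simp only [Finset.sum_sub_distrib, ← Finset.mul_sum]
    simp only [sub_eq_add_neg]
    exact (hγsq.hasSum.tendsto_sum_nat.const_mul (L ^ 2)).add_atBot
      (tendsto_neg_atTop_atBot.comp (hγdiv.const_mul_atTop (show 0 < 2 * μ by positivity)))
  have hsq := tendsto_zero_of_succ_le_of_sum_tendsto_atBot
    (a := fun n => ‖ζ n - ζstar‖ ^ 2) (fun n => sq_nonneg _) hstep hsum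
  rw [tendsto_iff_norm_sub_tendsto_zero]
  simpa [Real.sqrt_sq] using hsq.sqrt
end

section
/- Let H be a real Hilbert space, μ > 0, and let T : ℝ → H → H be such that for every time t the map T t is μ-strongly monotone. Suppose ζ* ∈ H satisfies T t ζ* = 0 for all t. Let (γ_n) be positive step sizes with ∑ γ_n = ∞, let (t_n) be any sequence of times, and let (ζ_n) be a sequence in H satisfying the implicit (resolvent) recursion ζ_{n+1} + γ_n · T t_n ζ_{n+1} = ζ_n for all n. Then ζ_n converges (in norm) to ζ*. -/
open RealInnerProductSpace Filter

/-- The resolvent step of a strongly monotone operator is a contraction: the estimate on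
displacement vectors. -/
lemma one_add_mul_norm_le_norm_add_smul_of_le_inner
    {H : Type*} [NormedAddCommGroup H] [InnerProductSpace ℝ H] {μ γ : ℝ} (hγ : 0 ≤ γ) {u v : H}
    (h : μ * ‖u‖ ^ 2 ≤ ⟪v, u⟫) : (1 + μ * γ) * ‖u‖ ≤ ‖u + γ • v‖ := by
  rcases (norm_nonneg u).eq_or_lt with hu | hu
  · simp [← hu]
  · have hinner : ⟪u + γ • v, u⟫ = ‖u‖ ^ 2 + γ * ⟪v, u⟫ := by
      rw [inner_add_left, real_inner_smul_left, real_inner_self_eq_norm_sq]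
    refine le_of_mul_le_mul_right ?_ hu
    calc (1 + μ * γ) * ‖u‖ * ‖u‖ = ‖u‖ ^ 2 + γ * (μ * ‖u‖ ^ 2) := by ring
      _ ≤ ‖u‖ ^ 2 + γ * ⟪v, u⟫ := by gcongr
      _ = ⟪u + γ • v, u⟫ := hinner.symm
      _ ≤ ‖u + γ • v‖ * ‖u‖ := real_inner_le_norm _ _

/-- A nonnegative sequence with `(1 + b n) * a (n + 1) ≤ a n` decays at least like the inverse of
the partial sums of `b`. -/
lemma one_add_sum_mul_le_of_one_add_mul_succ_le {a b : ℕ → ℝ} (ha : ∀ n, 0 ≤ a n)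
    (hb : ∀ n, 0 ≤ b n) (h : ∀ n, (1 + b n) * a (n + 1) ≤ a n) (N : ℕ) :
    (1 + ∑ n ∈ Finset.range N, b n) * a N ≤ a 0 := by
  induction N with
  | zero => simp
  | succ N ih =>
    have hS : 0 ≤ ∑ n ∈ Finset.range N, b n := Finset.sum_nonneg fun n _ => hb n
    have hprod := mul_nonneg (mul_nonneg hS (hb N)) (ha (N + 1))
    rw [Finset.sum_range_succ]
    calc (1 + (∑ n ∈ Finset.range N, b n + b N)) * a (N + 1)
        ≤ (1 + ∑ n ∈ Finset.range N, b n) * ((1 + b N) * a (N + 1)) := by linarith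
      _ ≤ (1 + ∑ n ∈ Finset.range N, b n) * a N := by gcongr; exact h N
      _ ≤ a 0 := ih

/-- Strong convergence of the implicit (resolvent) iteration for a dynamic,
strongly monotone operator (Algorithm 1 with backward steps). -/
theorem dynamic_svi_resolvent_strong_convergence
    {H : Type*} [NormedAddCommGroup H] [InnerProductSpace ℝ H] [CompleteSpace H]
    (μ : ℝ) (hμ : 0 < μ)
    (T : ℝ → H → H)
    (hmono : ∀ t : ℝ, ∀ x y : H, μ * ‖x - y‖ ^ 2 ≤ ⟪T t x - T t y, x - y⟫)
    (ζstar : H) (hzero : ∀ t : ℝ, T t ζstar = 0)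
    (γ : ℕ → ℝ) (hγpos : ∀ n, 0 < γ n)
    (hγdiv : Tendsto (fun N => ∑ n ∈ Finset.range N, γ n) atTop atTop)
    (t : ℕ → ℝ) (ζ : ℕ → H)
    (hrec : ∀ n, ζ (n + 1) + γ n • T (t n) (ζ (n + 1)) = ζ n) :
    Tendsto ζ atTop (nhds ζstar) := by
  have hstep (n : ℕ) : (1 + μ * γ n) * ‖ζ (n + 1) - ζstar‖ ≤ ‖ζ n - ζstar‖ := by
    have h := hmono (t n) (ζ (n + 1)) ζstar
    rw [hzero, sub_zero] at h
    have h_bound := one_add_mul_norm_le_norm_add_smul_of_le_inner (hγpos n).le h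
    rwa [sub_add_eq_add_sub, hrec] at h_bound
  have hsum : ∀ N, 0 ≤ ∑ n ∈ Finset.range N, γ n :=
    fun N => Finset.sum_nonneg fun n _ => (hγpos n).le
  have hlim : Tendsto (fun N => ‖ζ 0 - ζstar‖ / (1 + μ * ∑ n ∈ Finset.range N, γ n)) atTop
      (nhds 0) :=
    (tendsto_atTop_add_const_left _ 1 (hγdiv.const_mul_atTop hμ)).const_div_atTop _
  rw [tendsto_iff_norm_sub_tendsto_zero]
  refine squeeze_zero (fun n => norm_nonneg _) (fun N => ?_) hlim
  have hpos : 0 < 1 + μ * ∑ n ∈ Finset.range N, γ n := by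
    have := mul_nonneg hμ.le (hsum N)
    linarith
  rw [le_div_iff₀' hpos, Finset.mul_sum]
  exact one_add_sum_mul_le_of_one_add_mul_succ_le (a := fun n => ‖ζ n - ζstar‖)
    (fun n => norm_nonneg _) (fun n => mul_nonneg hμ.le (hγpos n).le) hstep N
end

section
/- Let μ, L, σ be real numbers with 0 < μ ≤ L, and let (a_n) be a sequence of nonnegative reals and (γ_n) a sequence of positive reals satisfying: γ_n ≤ μ/L² for all n, ∑ γ_n = ∞, ∑ γ_n² < ∞, and a_{n+1} ≤ (1 − 2μγ_n + L²γ_n²)·a_n + σ²γ_n² for all n. Then a_n → 0 as n → ∞. -/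
open Filter

open Finset in
/-- Iterating `u (n + 1) ≤ (1 - c n) * u n + b n` from `n` to `m`, using `1 - x ≤ exp (-x)`. -/
theorem le_exp_neg_mul_add_of_recursion {u c b : ℕ → ℝ} (hu : ∀ n, 0 ≤ u n) (hc : ∀ n, 0 ≤ c n)
    (hb : ∀ n, 0 ≤ b n) (hrec : ∀ n, u (n + 1) ≤ (1 - c n) * u n + b n) {n m : ℕ} (hnm : n ≤ m) :
    u m ≤ Real.exp (-∑ i ∈ Ico n m, c i) * u n + ∑ i ∈ Ico n m, b i := by
  induction m, hnm using Nat.le_induction with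
  | base => simp
  | succ m hnm ih =>
    have hexp : Real.exp (-c m) ≤ 1 := Real.exp_le_one_iff.2 (neg_nonpos.2 (hc m))
    have hsum : 0 ≤ ∑ i ∈ Ico n m, b i := sum_nonneg fun i _ => hb i
    rw [sum_Ico_succ_top hnm, sum_Ico_succ_top hnm, neg_add, Real.exp_add]
    calc u (m + 1) ≤ (1 - c m) * u m + b m := hrec m
      _ ≤ Real.exp (-c m) * u m + b m := by
        gcongr
        · exact hu m
        · exact Real.one_sub_le_exp_neg _
      _ ≤ Real.exp (-c m) * (Real.exp (-∑ i ∈ Ico n m, c i) * u n + ∑ i ∈ Ico n m, b i) + b m := by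
        gcongr
      _ ≤ _ := by linarith [mul_le_of_le_one_left hsum hexp]

/-- A nonnegative sequence with `u (n + 1) ≤ (1 - c n) * u n + b n`, where `∑ c n = ∞` and
`∑ b n < ∞`, tends to zero. -/
theorem tendsto_zero_of_recursion {u c b : ℕ → ℝ} (hu : ∀ n, 0 ≤ u n) (hc : ∀ n, 0 ≤ c n)
    (hb : ∀ n, 0 ≤ b n) (hcdiv : Tendsto (fun N => ∑ n ∈ Finset.range N, c n) atTop atTop)
    (hbsum : Summable b) (hrec : ∀ n, u (n + 1) ≤ (1 - c n) * u n + b n) :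
    Tendsto u atTop (nhds 0) := by
  refine tendsto_order.2 ⟨fun x hx => .of_forall fun n => hx.trans_le (hu n), fun ε hε => ?_⟩
  obtain ⟨n, hn⟩ := (hbsum.hasSum.tendsto_sum_nat.eventually_const_lt
    (sub_lt_self (∑' i, b i) (half_pos hε))).exists
  have hdecay : Tendsto (fun m => Real.exp (-∑ i ∈ Finset.Ico n m, c i) * u n) atTop (nhds 0) := by
    have hIco : Tendsto (fun m => ∑ i ∈ Finset.Ico n m, c i) atTop atTop := by
      refine (tendsto_atTop_add_const_right _ (-∑ i ∈ Finset.range n, c i) hcdiv).congr' ?_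
      filter_upwards [eventually_ge_atTop n] with m hm
      rw [Finset.sum_Ico_eq_sub _ hm, sub_eq_add_neg]
    simpa using (Real.tendsto_exp_neg_atTop_nhds_zero.comp hIco).mul_const (u n)
  filter_upwards [hdecay.eventually_lt_const (half_pos hε), eventually_ge_atTop n] with m hm hnm
  have hle := le_exp_neg_mul_add_of_recursion hu hc hb hrec hnm
  rw [Finset.sum_Ico_eq_sub b hnm] at hle
  linarith [hbsum.sum_le_tsum (Finset.range m) fun i _ => hb i]

/-- Robbins–Monro type recursion lemma: the expected squared error of the
stochastic iteration of Algorithm 2 tends to zero under the step-size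
conditions `∑ γ_n = ∞` and `∑ γ_n² < ∞`. -/
theorem robbins_monro_recursion
    (μ L σ : ℝ) (hμ : 0 < μ) (hμL : μ ≤ L)
    (a : ℕ → ℝ) (ha : ∀ n, 0 ≤ a n)
    (γ : ℕ → ℝ) (hγpos : ∀ n, 0 < γ n) (hγle : ∀ n, γ n ≤ μ / L ^ 2)
    (hγdiv : Tendsto (fun N => ∑ n ∈ Finset.range N, γ n) atTop atTop)
    (hγsq : Summable (fun n => (γ n) ^ 2))
    (hrec : ∀ n, a (n + 1) ≤ (1 - 2 * μ * γ n + L ^ 2 * (γ n) ^ 2) * a n + σ ^ 2 * (γ n) ^ 2) :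
    Tendsto a atTop (nhds 0) := by
  have hL : 0 < L ^ 2 := pow_pos (hμ.trans_le hμL) 2
  refine tendsto_zero_of_recursion (c := fun n => μ * γ n) (b := fun n => σ ^ 2 * γ n ^ 2) ha
    (fun n => (mul_pos hμ (hγpos n)).le) (fun n => by positivity) ?_ (hγsq.mul_left _) fun n => ?_
  · simpa only [Finset.mul_sum] using hγdiv.const_mul_atTop hμ
  · have hstep : L ^ 2 * γ n ^ 2 ≤ μ * γ n := by
      have := mul_le_mul_of_nonneg_right ((le_div_iff₀ hL).1 (hγle n)) (hγpos n).le
      linarith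
    refine (hrec n).trans ?_
    gcongr
    · exact ha n
    · linarith
end

section
/- Let H be a real Hilbert space, (Ω, ν) a probability space, and T : Ω → H → H a family of operators. Fix ζ, ζ* ∈ H and γ > 0, μ > 0, L > 0, σ ≥ 0. Assume: (i) ω ↦ T ω ζ is Bochner integrable and ω ↦ ‖T ω ζ‖² is integrable; (ii) the mean operator T̄ defined by T̄ x = ∫ T ω x dν(ω) is μ-strongly monotone and L-Lipschitz with T̄ ζ* = 0; (iii) the variance bound ∫ ‖T ω ζ − T̄ ζ‖² dν(ω) ≤ σ² holds. Then ∫ ‖(ζ − γ · T ω ζ) − ζ*‖² dν(ω) ≤ (1 − 2γμ + γ²L²)·‖ζ − ζ*‖² + γ²σ². -/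
open RealInnerProductSpace MeasureTheory

/-- Expansion of the mean squared distance between a fixed vector and a scaled random vector. -/
theorem integral_norm_sub_smul_sq
    {H : Type*} [NormedAddCommGroup H] [InnerProductSpace ℝ H] [CompleteSpace H]
    {Ω : Type*} [MeasurableSpace Ω] (ν : Measure Ω) [IsProbabilityMeasure ν]
    {X : Ω → H} (hX : Integrable X ν) (hX2 : Integrable (fun ω => ‖X ω‖ ^ 2) ν)
    (a : H) (c : ℝ) :
    ∫ ω, ‖a - c • X ω‖ ^ 2 ∂ν =
      ‖a‖ ^ 2 - 2 * c * ⟪a, ∫ ω, X ω ∂ν⟫ + c ^ 2 * ∫ ω, ‖X ω‖ ^ 2 ∂ν := by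
  have hinner : Integrable (fun ω => 2 * c * ⟪a, X ω⟫) ν := (hX.const_inner a).const_mul _
  have hexpand : ∀ ω, ‖a - c • X ω‖ ^ 2 =
      ‖a‖ ^ 2 - 2 * c * ⟪a, X ω⟫ + c ^ 2 * ‖X ω‖ ^ 2 := fun ω => by
    rw [norm_sub_sq_real, real_inner_smul_right, norm_smul, mul_pow, Real.norm_eq_abs, sq_abs]
    ring
  have hdiff : Integrable (fun ω => ‖a‖ ^ 2 - 2 * c * ⟪a, X ω⟫) ν :=
    (integrable_const _).sub hinner
  simp_rw [hexpand]
  rw [integral_add hdiff (hX2.const_mul _),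
    integral_sub (integrable_const _) hinner, integral_const_mul, integral_const_mul,
    integral_inner hX]
  simp

/-- One-step expected-error estimate for the stochastic forward iteration
of Algorithm 2. -/
theorem stochastic_one_step_estimate
    {H : Type*} [NormedAddCommGroup H] [InnerProductSpace ℝ H] [CompleteSpace H]
    {Ω : Type*} [MeasurableSpace Ω] (ν : Measure Ω) [IsProbabilityMeasure ν]
    (T : Ω → H → H) (ζ ζstar : H)
    (γ μ L σ : ℝ) (hγ : 0 < γ) (hμ : 0 < μ) (hL : 0 < L) (hσ : 0 ≤ σ)
    (hint : Integrable (fun ω => T ω ζ) ν)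
    (hint2 : Integrable (fun ω => ‖T ω ζ‖ ^ 2) ν)
    (hmono : ∀ x y : H, μ * ‖x - y‖ ^ 2 ≤ ⟪(∫ ω, T ω x ∂ν) - (∫ ω, T ω y ∂ν), x - y⟫)
    (hlip : ∀ x y : H, ‖(∫ ω, T ω x ∂ν) - (∫ ω, T ω y ∂ν)‖ ≤ L * ‖x - y‖)
    (hzero : (∫ ω, T ω ζstar ∂ν) = 0)
    (hvar : (∫ ω, ‖T ω ζ - (∫ ω', T ω' ζ ∂ν)‖ ^ 2 ∂ν) ≤ σ ^ 2) :
    (∫ ω, ‖(ζ - γ • T ω ζ) - ζstar‖ ^ 2 ∂ν) ≤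
      (1 - 2 * γ * μ + γ ^ 2 * L ^ 2) * ‖ζ - ζstar‖ ^ 2 + γ ^ 2 * σ ^ 2 := by
  have hstep := integral_norm_sub_smul_sq ν hint hint2 (ζ - ζstar) γ
  have hvariance := integral_norm_sub_smul_sq ν hint hint2 (∫ ω, T ω ζ ∂ν) 1
  have hm := hmono ζ ζstar
  have hl := hlip ζ ζstar
  rw [hzero, sub_zero] at hm hl
  rw [real_inner_comm] at hm
  simp_rw [one_smul, norm_sub_rev (∫ ω, T ω ζ ∂ν), real_inner_self_eq_norm_sq] at hvariance
  simp_rw [sub_right_comm ζ _ ζstar, hstep]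
  have hl2 : ‖∫ ω, T ω ζ ∂ν‖ ^ 2 ≤ L ^ 2 * ‖ζ - ζstar‖ ^ 2 := by
    rw [← mul_pow]
    gcongr
  have hsecond : ∫ ω, ‖T ω ζ‖ ^ 2 ∂ν ≤ L ^ 2 * ‖ζ - ζstar‖ ^ 2 + σ ^ 2 := by linarith
  have hscaled := mul_le_mul_of_nonneg_left hsecond (sq_nonneg γ)
  have hmscaled := mul_le_mul_of_nonneg_left hm hγ.le
  linarith
end

section
/- Let H₁ and H₂ be real Hilbert spaces, and let T₁ : H₁ → H₂ → H₁ and T₂ : H₂ → H₁ → H₂ satisfy, for constants μ₁, μ₂ > 0, L₁, L₂ > 0, κ₁, κ₂ ≥ 0: (i) for each ς ∈ H₂, the map ζ ↦ T₁ ζ ς is μ₁-strongly monotone and L₁-Lipschitz, and ‖T₁ ζ ς − T₁ ζ ς'‖ ≤ κ₁‖ς − ς'‖ for all ζ, ς, ς'; (ii) symmetrically, for each ζ ∈ H₁ the map ς ↦ T₂ ς ζ is μ₂-strongly monotone and L₂-Lipschitz, and ‖T₂ ς ζ − T₂ ς ζ'‖ ≤ κ₂‖ζ − ζ'‖; (iii)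 the coupling condition κ₁ + κ₂ < 2·√(μ₁μ₂) holds; (iv) (ζ*, ς*) satisfies T₁ ζ* ς* = 0 and T₂ ς* ζ* = 0. Then there exists γ̄ > 0 such that for every sequence of step sizes (γ_n) with 0 < γ_n ≤ γ̄ and ∑ γ_n = ∞, the alternating iterates defined by ζ_{n+1} = ζ_n − γ_n · T₁ ζ_n ς_n and ς_{n+1} = ς_n − γ_n · T₂ ς_n ζ_{n+1} converge in norm to (ζ*, ς*). -/
open RealInnerProductSpace Filter

section Helpers

variable {E F : Type*} [NormedAddCommGroup E] [NormedAddCommGroup F]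

theorem norm_le_of_lipschitz_of_cross {T : E → F → E} {L κ : ℝ}
    (hlip : ∀ w x y, ‖T x w - T y w‖ ≤ L * ‖x - y‖)
    (hcross : ∀ x w w', ‖T x w - T x w'‖ ≤ κ * ‖w - w'‖)
    {x₀ : E} {w₀ : F} (hzero : T x₀ w₀ = 0) (x : E) (w : F) :
    ‖T x w‖ ≤ L * ‖x - x₀‖ + κ * ‖w - w₀‖ := by
  have h : T x w = (T x w - T x₀ w) + (T x₀ w - T x₀ w₀) := by simp [hzero]
  rw [h]
  exact (norm_add_le _ _).trans (add_le_add (hlip w x x₀) (hcross x₀ w w₀))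

variable [InnerProductSpace ℝ E]

theorem inner_ge_of_strongMono_of_cross {T : E → F → E} {μ κ : ℝ}
    (hmono : ∀ w x y, μ * ‖x - y‖ ^ 2 ≤ ⟪T x w - T y w, x - y⟫)
    (hcross : ∀ x w w', ‖T x w - T x w'‖ ≤ κ * ‖w - w'‖)
    {x₀ : E} {w₀ : F} (hzero : T x₀ w₀ = 0) (x : E) (w : F) :
    μ * ‖x - x₀‖ ^ 2 - κ * ‖w - w₀‖ * ‖x - x₀‖ ≤ ⟪T x w, x - x₀⟫ := by
  have h : T x w = (T x w - T x₀ w) + (T x₀ w - T x₀ w₀) := by simp [hzero]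
  rw [h, inner_add_left]
  have h₁ := hmono w x x₀
  have h₂ : |⟪T x₀ w - T x₀ w₀, x - x₀⟫| ≤ κ * ‖w - w₀‖ * ‖x - x₀‖ :=
    (abs_real_inner_le_norm _ _).trans
      (mul_le_mul_of_nonneg_right (hcross x₀ w w₀) (norm_nonneg _))
  linarith [(abs_le.1 h₂).1]

theorem norm_sub_smul_sub_sq (x t x₀ : E) (γ : ℝ) :
    ‖x - γ • t - x₀‖ ^ 2 = ‖x - x₀‖ ^ 2 - 2 * γ * ⟪t, x - x₀⟫ + γ ^ 2 * ‖t‖ ^ 2 := by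
  rw [sub_right_comm, norm_sub_sq_real, inner_smul_right, real_inner_comm, norm_smul, mul_pow,
    Real.norm_eq_abs, sq_abs]
  ring

end Helpers

theorem exists_coercivity_const {μ₁ μ₂ K : ℝ} (hμ₁ : 0 < μ₁) (hμ₂ : 0 < μ₂) (hK : 0 ≤ K)
    (h : K < 2 * Real.sqrt (μ₁ * μ₂)) :
    ∃ c > 0, ∀ a b : ℝ, c * (a ^ 2 + b ^ 2) ≤ μ₁ * a ^ 2 + μ₂ * b ^ 2 - K * (a * b) := by
  have hs : Real.sqrt (μ₁ * μ₂) ^ 2 = μ₁ * μ₂ := Real.sq_sqrt (by positivity)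
  have hK2 : K ^ 2 < 4 * (μ₁ * μ₂) := by
    rw [← hs]
    nlinarith
  obtain ⟨c, hc⟩ : ∃ c, c = (4 * (μ₁ * μ₂) - K ^ 2) / (4 * (μ₁ + μ₂)) := ⟨_, rfl⟩
  have hcpos : 0 < c := by
    rw [hc]
    exact div_pos (by linarith) (by linarith)
  have hceq : 4 * c * (μ₁ + μ₂) = 4 * (μ₁ * μ₂) - K ^ 2 := by
    rw [hc]
    field_simp
  have hc₁ : 0 < μ₁ - c := by
    by_contra! hle
    nlinarith [mul_nonneg (sub_nonneg.2 (sub_nonpos.1 hle)) hμ₂.le, mul_pos hcpos hμ₁, sq_nonneg K]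
  refine ⟨c, hcpos, fun a b => ?_⟩
  have key : 0 ≤ 4 * (μ₁ - c) * ((μ₁ - c) * a ^ 2 + (μ₂ - c) * b ^ 2 - K * (a * b)) := by
    have : 4 * (μ₁ - c) * ((μ₁ - c) * a ^ 2 + (μ₂ - c) * b ^ 2 - K * (a * b)) =
        (2 * (μ₁ - c) * a - K * b) ^ 2 + (2 * c * b) ^ 2 := by
      linear_combination (-b ^ 2) * hceq
    rw [this]
    positivity
  have := nonneg_of_mul_nonneg_right key (by linarith)
  linarith

theorem tendsto_zero_of_le_one_sub_mul {V γ : ℕ → ℝ} {c : ℝ} (hc : 0 < c) (hV : ∀ n, 0 ≤ V n)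
    (hstep : ∀ n, V (n + 1) ≤ (1 - c * γ n) * V n)
    (hγ : Tendsto (fun N => ∑ n ∈ Finset.range N, γ n) atTop atTop) :
    Tendsto V atTop (nhds 0) := by
  have hbound : ∀ N, V N ≤ Real.exp (-(c * ∑ n ∈ Finset.range N, γ n)) * V 0 := by
    intro N
    induction N with
    | zero => simp
    | succ N ih =>
      calc V (N + 1) ≤ (1 - c * γ N) * V N := hstep N
        _ ≤ Real.exp (-(c * γ N)) * V N :=
          mul_le_mul_of_nonneg_right (Real.one_sub_le_exp_neg _) (hV N)
        _ ≤ Real.exp (-(c * γ N)) * (Real.exp (-(c * ∑ n ∈ Finset.range N, γ n)) * V 0) :=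
          mul_le_mul_of_nonneg_left ih (Real.exp_pos _).le
        _ = Real.exp (-(c * ∑ n ∈ Finset.range (N + 1), γ n)) * V 0 := by
          rw [← mul_assoc, ← Real.exp_add, Finset.sum_range_succ]
          ring_nf
  refine squeeze_zero hV hbound ?_
  simpa using (Real.tendsto_exp_neg_atTop_nhds_zero.comp (hγ.const_mul_atTop hc)).mul_const (V 0)

theorem tendsto_of_norm_sub_sq_le {E : Type*} [NormedAddCommGroup E] {x : ℕ → E} {x₀ : E}
    {V : ℕ → ℝ} (hV : Tendsto V atTop (nhds 0)) (h : ∀ n, ‖x n - x₀‖ ^ 2 ≤ V n) :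
    Tendsto x atTop (nhds x₀) := by
  rw [tendsto_iff_norm_sub_tendsto_zero]
  have := (squeeze_zero (fun n => sq_nonneg _) h hV).sqrt
  simpa using this

/-- The scalar estimate behind one alternating step: `a`, `b` are the current errors, `a'` is the
updated first error, `s`, `t` are the operator norms and `p`, `q` the inner products. -/
theorem alternating_step_estimate {μ₁ μ₂ L₁ L₂ κ₁ κ₂ c M γ a b a' s t p q : ℝ}
    (hL₁ : 0 ≤ L₁) (hL₂ : 0 ≤ L₂) (hκ₁ : 0 ≤ κ₁) (hκ₂ : 0 ≤ κ₂)
    (hM : M = 1 + L₁ + L₂ + κ₁ + κ₂)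
    (hcoer : c * (a ^ 2 + b ^ 2) ≤ μ₁ * a ^ 2 + μ₂ * b ^ 2 - (κ₁ + κ₂) * (a * b))
    (hγ : 0 < γ) (hγ1 : γ ≤ 1) (hγM : γ * (14 * M ^ 4) ≤ c)
    (ha : 0 ≤ a) (hb : 0 ≤ b) (hs : 0 ≤ s) (ht : 0 ≤ t)
    (hsle : s ≤ L₁ * a + κ₁ * b) (hp : μ₁ * a ^ 2 - κ₁ * b * a ≤ p)
    (ha'le : a' ≤ a + γ * s)
    (htle : t ≤ L₂ * b + κ₂ * a') (hq : μ₂ * b ^ 2 - κ₂ * a' * b ≤ q) :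
    (a ^ 2 - 2 * γ * p + γ ^ 2 * s ^ 2) + (b ^ 2 - 2 * γ * q + γ ^ 2 * t ^ 2) ≤
      (1 - c * γ) * (a ^ 2 + b ^ 2) := by
  have hM1 : 1 ≤ M := by linarith
  have hM2 : M ≤ M ^ 2 := by nlinarith
  have hM4 : M ^ 2 ≤ M ^ 4 := by nlinarith [sq_nonneg M]
  have hab : 0 ≤ a + b := by linarith
  have hsM : s ≤ M * (a + b) := by
    have h₁ : L₁ * a ≤ M * a := mul_le_mul_of_nonneg_right (by linarith) ha
    have h₂ : κ₁ * b ≤ M * b := mul_le_mul_of_nonneg_right (by linarith) hb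
    linarith
  have ha'M : a' ≤ M * (a + b) := by
    have h₁ : γ * s ≤ L₁ * a + κ₁ * b := (mul_le_of_le_one_left hs hγ1).trans hsle
    have h₂ : (1 + L₁) * a ≤ M * a := mul_le_mul_of_nonneg_right (by linarith) ha
    have h₃ : κ₁ * b ≤ M * b := mul_le_mul_of_nonneg_right (by linarith) hb
    linarith
  have htM : t ≤ 2 * M ^ 2 * (a + b) := by
    have h₁ : κ₂ * a' ≤ M * (M * (a + b)) :=
      (mul_le_mul_of_nonneg_left ha'M hκ₂).trans
        (mul_le_mul_of_nonneg_right (by linarith) (by positivity))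
    have h₂ : L₂ * b ≤ M ^ 2 * (a + b) :=
      mul_le_mul (by linarith) (by linarith) hb (by positivity)
    linarith
  have hs2 : s ^ 2 ≤ M ^ 4 * (a + b) ^ 2 := by
    calc s ^ 2 ≤ (M * (a + b)) ^ 2 := pow_le_pow_left₀ hs hsM 2
      _ = M ^ 2 * (a + b) ^ 2 := by ring
      _ ≤ M ^ 4 * (a + b) ^ 2 := mul_le_mul_of_nonneg_right hM4 (sq_nonneg _)
  have ht2 : t ^ 2 ≤ 4 * M ^ 4 * (a + b) ^ 2 := by
    calc t ^ 2 ≤ (2 * M ^ 2 * (a + b)) ^ 2 := pow_le_pow_left₀ ht htM 2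
      _ = 4 * M ^ 4 * (a + b) ^ 2 := by ring
  have hcr : κ₂ * b * s ≤ M ^ 4 * (a + b) ^ 2 := by
    calc κ₂ * b * s ≤ (M * (a + b)) * (M * (a + b)) :=
          mul_le_mul (mul_le_mul (by linarith) (by linarith) hb (by linarith)) hsM hs
            (by positivity)
      _ = M ^ 2 * (a + b) ^ 2 := by ring
      _ ≤ M ^ 4 * (a + b) ^ 2 := mul_le_mul_of_nonneg_right hM4 (sq_nonneg _)
  have hq' : μ₂ * b ^ 2 - κ₂ * a * b - γ * (κ₂ * b * s) ≤ q := by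
    have := mul_le_mul_of_nonneg_left ha'le (mul_nonneg hκ₂ hb)
    linarith
  have hpq : c * (a ^ 2 + b ^ 2) - γ * (κ₂ * b * s) ≤ p + q := by linarith
  have hquad : 2 * (κ₂ * b * s) + s ^ 2 + t ^ 2 ≤ 14 * M ^ 4 * (a ^ 2 + b ^ 2) := by
    have : M ^ 4 * (a + b) ^ 2 ≤ M ^ 4 * (2 * (a ^ 2 + b ^ 2)) :=
      mul_le_mul_of_nonneg_left (by linarith [sq_nonneg (a - b)]) (by positivity)
    linarith
  have h₁ := mul_le_mul_of_nonneg_left hpq hγ.le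
  have h₂ := mul_le_mul_of_nonneg_left hquad (sq_nonneg γ)
  have h₃ := mul_le_mul_of_nonneg_right hγM
    (mul_nonneg hγ.le (add_nonneg (sq_nonneg a) (sq_nonneg b)))
  linarith

/-- Strong convergence of the alternating iteration for the coupled
(multi-agent) split variational inclusion (Algorithm 3). -/
theorem coupled_svi_strong_convergence
    {H₁ : Type*} [NormedAddCommGroup H₁] [InnerProductSpace ℝ H₁] [CompleteSpace H₁]
    {H₂ : Type*} [NormedAddCommGroup H₂] [InnerProductSpace ℝ H₂] [CompleteSpace H₂]
    (T₁ : H₁ → H₂ → H₁) (T₂ : H₂ → H₁ → H₂)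
    (μ₁ μ₂ L₁ L₂ κ₁ κ₂ : ℝ)
    (hμ₁ : 0 < μ₁) (hμ₂ : 0 < μ₂) (hL₁ : 0 < L₁) (hL₂ : 0 < L₂)
    (hκ₁ : 0 ≤ κ₁) (hκ₂ : 0 ≤ κ₂)
    (hmono₁ : ∀ ς : H₂, ∀ x y : H₁, μ₁ * ‖x - y‖ ^ 2 ≤ ⟪T₁ x ς - T₁ y ς, x - y⟫)
    (hlip₁ : ∀ ς : H₂, ∀ x y : H₁, ‖T₁ x ς - T₁ y ς‖ ≤ L₁ * ‖x - y‖)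
    (hcross₁ : ∀ ζ : H₁, ∀ ς ς' : H₂, ‖T₁ ζ ς - T₁ ζ ς'‖ ≤ κ₁ * ‖ς - ς'‖)
    (hmono₂ : ∀ ζ : H₁, ∀ x y : H₂, μ₂ * ‖x - y‖ ^ 2 ≤ ⟪T₂ x ζ - T₂ y ζ, x - y⟫)
    (hlip₂ : ∀ ζ : H₁, ∀ x y : H₂, ‖T₂ x ζ - T₂ y ζ‖ ≤ L₂ * ‖x - y‖)
    (hcross₂ : ∀ ς : H₂, ∀ ζ ζ' : H₁, ‖T₂ ς ζ - T₂ ς ζ'‖ ≤ κ₂ * ‖ζ - ζ'‖)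
    (hcoupling : κ₁ + κ₂ < 2 * Real.sqrt (μ₁ * μ₂))
    (ζstar : H₁) (ςstar : H₂)
    (hzero₁ : T₁ ζstar ςstar = 0) (hzero₂ : T₂ ςstar ζstar = 0) :
    ∃ γbar : ℝ, 0 < γbar ∧
      ∀ γ : ℕ → ℝ, (∀ n, 0 < γ n) → (∀ n, γ n ≤ γbar) →
        Tendsto (fun N => ∑ n ∈ Finset.range N, γ n) atTop atTop →
        ∀ ζ : ℕ → H₁, ∀ ς : ℕ → H₂,
          (∀ n, ζ (n + 1) = ζ n - γ n • T₁ (ζ n) (ς n)) →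
          (∀ n, ς (n + 1) = ς n - γ n • T₂ (ς n) (ζ (n + 1))) →
          Tendsto ζ atTop (nhds ζstar) ∧ Tendsto ς atTop (nhds ςstar) := by
  obtain ⟨c, hc, hcoer⟩ := exists_coercivity_const hμ₁ hμ₂ (add_nonneg hκ₁ hκ₂) hcoupling
  obtain ⟨M, hM⟩ : ∃ M, M = 1 + L₁ + L₂ + κ₁ + κ₂ := ⟨_, rfl⟩
  have hMpos : 0 < 14 * M ^ 4 := by
    have : 0 < M := by linarith
    positivity
  refine ⟨min 1 (c / (14 * M ^ 4)), lt_min one_pos (div_pos hc hMpos), ?_⟩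
  intro γ hγ hγle hsum ζ ς hζ hς
  have hV : Tendsto (fun n => ‖ζ n - ζstar‖ ^ 2 + ‖ς n - ςstar‖ ^ 2) atTop (nhds 0) := by
    refine tendsto_zero_of_le_one_sub_mul hc (fun n => by positivity) (fun n => ?_) hsum
    have ha' : ‖ζ (n + 1) - ζstar‖ ≤ ‖ζ n - ζstar‖ + γ n * ‖T₁ (ζ n) (ς n)‖ := by
      rw [hζ n, sub_right_comm]
      refine (norm_sub_le _ _).trans_eq ?_
      rw [norm_smul, Real.norm_of_nonneg (hγ n).le]
    have hstep := alternating_step_estimate hL₁.le hL₂.le hκ₁ hκ₂ hM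
      (hcoer ‖ζ n - ζstar‖ ‖ς n - ςstar‖) (hγ n) ((hγle n).trans (min_le_left _ _))
      ((le_div_iff₀ hMpos).1 ((hγle n).trans (min_le_right _ _)))
      (norm_nonneg _) (norm_nonneg _) (norm_nonneg _) (norm_nonneg _)
      (norm_le_of_lipschitz_of_cross hlip₁ hcross₁ hzero₁ (ζ n) (ς n))
      (inner_ge_of_strongMono_of_cross hmono₁ hcross₁ hzero₁ (ζ n) (ς n)) ha'
      (norm_le_of_lipschitz_of_cross hlip₂ hcross₂ hzero₂ (ς n) (ζ (n + 1)))
      (inner_ge_of_strongMono_of_cross hmono₂ hcross₂ hzero₂ (ς n) (ζ (n + 1)))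
    rwa [← norm_sub_smul_sub_sq, ← norm_sub_smul_sub_sq, ← hζ n, ← hς n] at hstep
  exact ⟨tendsto_of_norm_sub_sq_le hV fun n => le_add_of_nonneg_right (sq_nonneg _),
    tendsto_of_norm_sub_sq_le hV fun n => le_add_of_nonneg_left (sq_nonneg _)⟩
end

section
/- Let H₁ and H₂ be real Hilbert spaces, and let T₁ : H₁ → H₂ → H₁ and T₂ : H₂ → H₁ → H₂ satisfy, for constants μ₁, μ₂ > 0, L₁, L₂ > 0, κ₁, κ₂ ≥ 0: for each ς, the map ζ ↦ T₁ ζ ς is μ₁-strongly monotone and L₁-Lipschitz, and ‖T₁ ζ ς − T₁ ζ ς'‖ ≤ κ₁‖ς − ς'‖ for all ζ, ς, ς'; symmetrically for T₂ with μ₂, L₂, κ₂. If κ₁·κ₂ < μ₁·μ₂, then there exists a unique pair (ζ*, ς*) ∈ H₁ × H₂ with T₁ ζ* ς* = 0 and T₂ ς* ζ* = 0. -/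
open RealInnerProductSpace

/-- A strongly monotone map expands distances by at least its monotonicity constant. -/
theorem mul_norm_sub_le_of_strongly_monotone
    {H : Type*} [NormedAddCommGroup H] [InnerProductSpace ℝ H] {S : H → H} {μ : ℝ}
    (hmono : ∀ x y : H, μ * ‖x - y‖ ^ 2 ≤ ⟪S x - S y, x - y⟫) (x y : H) :
    μ * ‖x - y‖ ≤ ‖S x - S y‖ := by
  rcases (norm_nonneg (x - y)).eq_or_lt with h | h
  · rw [← h, mul_zero]
    exact norm_nonneg _
  · refine le_of_mul_le_mul_right ?_ h
    calc μ * ‖x - y‖ * ‖x - y‖ = μ * ‖x - y‖ ^ 2 := by ring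
      _ ≤ ⟪S x - S y, x - y⟫ := hmono x y
      _ ≤ ‖S x - S y‖ * ‖x - y‖ := real_inner_le_norm _ _

/-- A map on a complete metric space which contracts distances by a real factor `c < 1`
has a fixed point. -/
theorem exists_fixed_point_of_dist_le {α : Type*} [MetricSpace α] [CompleteSpace α] [Nonempty α]
    {f : α → α} {c : ℝ} (hc₀ : 0 ≤ c) (hc₁ : c < 1)
    (hf : ∀ x y, dist (f x) (f y) ≤ c * dist x y) : ∃ x, f x = x := by
  have hcontr : ContractingWith ⟨c, hc₀⟩ f :=
    ⟨by exact_mod_cast hc₁, LipschitzWith.of_dist_le_mul hf⟩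
  exact ⟨_, hcontr.fixedPoint_isFixedPt⟩

/-- A strongly monotone Lipschitz map on a Hilbert space has a zero. -/
theorem exists_zero_of_strongly_monotone_of_lipschitz
    {H : Type*} [NormedAddCommGroup H] [InnerProductSpace ℝ H] [CompleteSpace H]
    {S : H → H} {μ L : ℝ} (hμ : 0 < μ)
    (hmono : ∀ x y : H, μ * ‖x - y‖ ^ 2 ≤ ⟪S x - S y, x - y⟫)
    (hlip : ∀ x y : H, ‖S x - S y‖ ≤ L * ‖x - y‖) : ∃ x, S x = 0 := by
  have hD : 0 < L ^ 2 + μ ^ 2 := by positivity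
  obtain ⟨t, ht⟩ : ∃ t, t = μ / (L ^ 2 + μ ^ 2) := ⟨_, rfl⟩
  have ht₀ : 0 < t := ht ▸ div_pos hμ hD
  have htD : t * (L ^ 2 + μ ^ 2) = μ := by rw [ht, div_mul_cancel₀ _ hD.ne']
  have htL : t ^ 2 * L ^ 2 ≤ t * μ := by
    have : t * (t * (L ^ 2 + μ ^ 2)) = t * μ := by rw [htD]
    nlinarith [sq_nonneg (t * μ)]
  have htμ : t * μ ≤ 1 := by
    rw [ht, div_mul_eq_mul_div, div_le_one hD]
    nlinarith [sq_nonneg L]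
  obtain ⟨x, hx⟩ := exists_fixed_point_of_dist_le (f := fun x => x - t • S x)
    (c := √(1 - t * μ)) (Real.sqrt_nonneg _)
    (by rw [Real.sqrt_lt' one_pos]; nlinarith [mul_pos ht₀ hμ]) (by
      intro x y
      rw [dist_eq_norm, dist_eq_norm]
      refine le_of_sq_le_sq ?_ (by positivity)
      have hexp : ‖x - t • S x - (y - t • S y)‖ ^ 2
          = ‖x - y‖ ^ 2 - 2 * t * ⟪S x - S y, x - y⟫ + t ^ 2 * ‖S x - S y‖ ^ 2 := by
        rw [show x - t • S x - (y - t • S y) = (x - y) - t • (S x - S y) by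
          rw [smul_sub]; abel, norm_sub_sq_real, real_inner_smul_right, norm_smul, mul_pow,
          Real.norm_eq_abs, sq_abs, real_inner_comm]
        ring
      have hS : ‖S x - S y‖ ^ 2 ≤ L ^ 2 * ‖x - y‖ ^ 2 := by
        rw [← mul_pow]
        exact pow_le_pow_left₀ (norm_nonneg _) (hlip x y) 2
      rw [hexp, mul_pow, Real.sq_sqrt (by linarith)]
      have h₁ := mul_le_mul_of_nonneg_left (hmono x y) ht₀.le
      have h₂ := mul_le_mul_of_nonneg_left hS (sq_nonneg t)
      have h₃ := mul_le_mul_of_nonneg_right htL (sq_nonneg ‖x - y‖)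
      linarith)
  have hS : t • S x = 0 := sub_eq_self.mp hx
  exact ⟨x, (smul_eq_zero.mp hS).resolve_left ht₀.ne'⟩

/-- Zeros of a parametrised strongly monotone map depend on the parameter in a Lipschitz way. -/
theorem mul_norm_sub_le_of_zeros
    {H G : Type*} [NormedAddCommGroup H] [InnerProductSpace ℝ H] [NormedAddCommGroup G]
    {T : H → G → H} {μ κ : ℝ}
    (hmono : ∀ ς : G, ∀ x y : H, μ * ‖x - y‖ ^ 2 ≤ ⟪T x ς - T y ς, x - y⟫)
    (hcross : ∀ ζ : H, ∀ ς ς' : G, ‖T ζ ς - T ζ ς'‖ ≤ κ * ‖ς - ς'‖)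
    {x y : H} {ς ς' : G} (hx : T x ς = 0) (hy : T y ς' = 0) :
    μ * ‖x - y‖ ≤ κ * ‖ς - ς'‖ := by
  calc μ * ‖x - y‖ ≤ ‖T x ς - T y ς‖ := mul_norm_sub_le_of_strongly_monotone (hmono ς) x y
    _ = ‖T y ς - T y ς'‖ := by rw [hx, hy, zero_sub, sub_zero, norm_neg]
    _ ≤ κ * ‖ς - ς'‖ := hcross y ς ς'

/-- Existence and uniqueness of solutions of the coupled split variational
inclusion under strong monotonicity, Lipschitz continuity, and the coupling
condition `κ₁κ₂ < μ₁μ₂`. -/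
theorem coupled_svi_existence_uniqueness
    {H₁ : Type*} [NormedAddCommGroup H₁] [InnerProductSpace ℝ H₁] [CompleteSpace H₁]
    {H₂ : Type*} [NormedAddCommGroup H₂] [InnerProductSpace ℝ H₂] [CompleteSpace H₂]
    (T₁ : H₁ → H₂ → H₁) (T₂ : H₂ → H₁ → H₂)
    (μ₁ μ₂ L₁ L₂ κ₁ κ₂ : ℝ)
    (hμ₁ : 0 < μ₁) (hμ₂ : 0 < μ₂) (hL₁ : 0 < L₁) (hL₂ : 0 < L₂)
    (hκ₁ : 0 ≤ κ₁) (hκ₂ : 0 ≤ κ₂)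
    (hmono₁ : ∀ ς : H₂, ∀ x y : H₁, μ₁ * ‖x - y‖ ^ 2 ≤ ⟪T₁ x ς - T₁ y ς, x - y⟫)
    (hlip₁ : ∀ ς : H₂, ∀ x y : H₁, ‖T₁ x ς - T₁ y ς‖ ≤ L₁ * ‖x - y‖)
    (hcross₁ : ∀ ζ : H₁, ∀ ς ς' : H₂, ‖T₁ ζ ς - T₁ ζ ς'‖ ≤ κ₁ * ‖ς - ς'‖)
    (hmono₂ : ∀ ζ : H₁, ∀ x y : H₂, μ₂ * ‖x - y‖ ^ 2 ≤ ⟪T₂ x ζ - T₂ y ζ, x - y⟫)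
    (hlip₂ : ∀ ζ : H₁, ∀ x y : H₂, ‖T₂ x ζ - T₂ y ζ‖ ≤ L₂ * ‖x - y‖)
    (hcross₂ : ∀ ς : H₂, ∀ ζ ζ' : H₁, ‖T₂ ς ζ - T₂ ς ζ'‖ ≤ κ₂ * ‖ζ - ζ'‖)
    (hcoupling : κ₁ * κ₂ < μ₁ * μ₂) :
    ∃! p : H₁ × H₂, T₁ p.1 p.2 = 0 ∧ T₂ p.2 p.1 = 0 := by
  choose R₁ hR₁ using fun ς =>
    exists_zero_of_strongly_monotone_of_lipschitz hμ₁ (hmono₁ ς) (hlip₁ ς)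
  choose R₂ hR₂ using fun ζ =>
    exists_zero_of_strongly_monotone_of_lipschitz hμ₂ (hmono₂ ζ) (hlip₂ ζ)
  have hμ : 0 < μ₁ * μ₂ := mul_pos hμ₁ hμ₂
  have key : ∀ {a b x y : H₁} {u v : H₂}, T₁ x u = 0 → T₁ y v = 0 → T₂ u a = 0 → T₂ v b = 0 →
      μ₁ * μ₂ * ‖x - y‖ ≤ κ₁ * κ₂ * ‖a - b‖ := by
    intro a b x y u v hx hy hu hv
    have h₁ := mul_le_mul_of_nonneg_left (mul_norm_sub_le_of_zeros hmono₁ hcross₁ hx hy) hμ₂.le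
    have h₂ := mul_le_mul_of_nonneg_left (mul_norm_sub_le_of_zeros hmono₂ hcross₂ hu hv) hκ₁
    linarith
  obtain ⟨ζ, hζ⟩ := exists_fixed_point_of_dist_le (f := fun ζ => R₁ (R₂ ζ))
    (c := κ₁ * κ₂ / (μ₁ * μ₂)) (by positivity) ((div_lt_one hμ).mpr hcoupling) (by
      intro x y
      rw [dist_eq_norm, dist_eq_norm, div_mul_eq_mul_div, le_div_iff₀' hμ]
      exact key (hR₁ _) (hR₁ _) (hR₂ _) (hR₂ _))
  have hζ₁ : T₁ ζ (R₂ ζ) = 0 := by simpa only [hζ] using hR₁ (R₂ ζ)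
  refine ⟨(ζ, R₂ ζ), ⟨hζ₁, hR₂ ζ⟩, ?_⟩
  rintro ⟨x, u⟩ ⟨hx, hu⟩
  have hxζ : x = ζ := by
    have h := key hx hζ₁ hu (hR₂ ζ)
    refine sub_eq_zero.mp (norm_eq_zero.mp (le_antisymm ?_ (norm_nonneg _)))
    nlinarith [norm_nonneg (x - ζ)]
  subst hxζ
  have h := mul_norm_sub_le_of_zeros hmono₂ hcross₂ hu (hR₂ x)
  rw [sub_self, norm_zero, mul_zero] at h
  have hu' : u = R₂ x := sub_eq_zero.mp (norm_eq_zero.mp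
    (le_antisymm (nonpos_of_mul_nonpos_right h hμ₂) (norm_nonneg _)))
  rw [hu']
end

section
/- Let H be a real Hilbert space and let T : H → H be monotone and L-Lipschitz for some L > 0, with at least one zero (∃ z, T z = 0). Let (γ_n) be step sizes with γ_n ≥ γ̄ for some γ̄ > 0, and let (ζ_n) be a sequence in H satisfying the proximal-point (resolvent) recursion ζ_{n+1} + γ_n · T ζ_{n+1} = ζ_n for all n. Then there exists ζ* ∈ H with T ζ* = 0 such that (ζ_n) converges weakly to ζ*. -/
open RealInnerProductSpace Filter

/-- Every bounded sequence in a real Hilbert space converges weakly along every ultrafilter. -/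
theorem exists_weak_limit_of_ultrafilter
    {H ι : Type*} [NormedAddCommGroup H] [InnerProductSpace ℝ H] [CompleteSpace H]
    {u : ι → H} {R : ℝ} (hu : ∀ i, ‖u i‖ ≤ R) (U : Ultrafilter ι) :
    ∃ p : H, ∀ y : H, Tendsto (fun i => ⟪u i, y⟫) U (nhds ⟪p, y⟫) := by
  have hcomp := WeakDual.isCompact_closedBall (𝕜 := ℝ) (0 : StrongDual ℝ H) R
  let f : ι → WeakDual ℝ H := fun i =>
    StrongDual.toWeakDual (InnerProductSpace.toDual ℝ H (u i))
  have hmem : ∀ i, f i ∈ WeakDual.toStrongDual ⁻¹' Metric.closedBall (0 : StrongDual ℝ H) R := by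
    intro i
    simpa [f] using hu i
  obtain ⟨φ, -, hφ⟩ := hcomp.ultrafilter_le_nhds' (U.map f) (mem_map.mpr (Eventually.of_forall hmem))
  have hφ' : Tendsto f U (nhds φ) := hφ
  refine ⟨(InnerProductSpace.toDual ℝ H).symm (WeakDual.toStrongDual φ), fun y => ?_⟩
  have h := (WeakDual.eval_continuous y).continuousAt.tendsto.comp hφ'
  simpa [f, Function.comp_def] using h

/-- A Lipschitz operator satisfying the Minty variational inequality at `p` vanishes at `p`. -/
theorem eq_zero_of_minty
    {H : Type*} [NormedAddCommGroup H] [InnerProductSpace ℝ H]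
    {L : ℝ} (hL : 0 < L) {T : H → H} (hlip : ∀ x y : H, ‖T x - T y‖ ≤ L * ‖x - y‖)
    {p : H} (hp : ∀ x : H, 0 ≤ ⟪T x, x - p⟫) : T p = 0 := by
  set t : ℝ := 1 / (2 * L)
  have ht : 0 < t := by positivity
  set x := p - t • T p with hx
  have h1 : ⟪T x, T p⟫ ≤ 0 := by
    have h := hp x
    rw [hx, sub_sub_cancel_left, ← hx, inner_neg_right, real_inner_smul_right] at h
    exact nonpos_of_mul_nonpos_right (by linarith) ht
  have h2 : ‖T p - T x‖ ≤ ‖T p‖ / 2 := by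
    refine (hlip p x).trans_eq ?_
    rw [hx, sub_sub_cancel, norm_smul, Real.norm_of_nonneg ht.le]
    simp only [t]
    field_simp
  have h3 : ⟪T p - T x, T p⟫ ≤ ‖T p‖ / 2 * ‖T p‖ :=
    (real_inner_le_norm _ _).trans (by gcongr)
  rw [inner_sub_left, real_inner_self_eq_norm_sq] at h3
  have h4 : ‖T p‖ ^ 2 ≤ 0 := by linarith
  exact norm_eq_zero.mp (pow_eq_zero_iff two_ne_zero |>.mp (le_antisymm h4 (sq_nonneg _)))

/-- Demiclosedness at zero of a monotone Lipschitz operator. -/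
theorem eq_zero_of_weak_limit
    {H ι : Type*} [NormedAddCommGroup H] [InnerProductSpace ℝ H]
    {L : ℝ} (hL : 0 < L) {T : H → H}
    (hmono : ∀ x y : H, 0 ≤ ⟪T x - T y, x - y⟫)
    (hlip : ∀ x y : H, ‖T x - T y‖ ≤ L * ‖x - y‖)
    {l : Filter ι} [l.NeBot] {u : ι → H} {R : ℝ} (hu : ∀ i, ‖u i‖ ≤ R)
    (hT : Tendsto (fun i => T (u i)) l (nhds 0))
    {p : H} (hp : ∀ y : H, Tendsto (fun i => ⟪u i, y⟫) l (nhds ⟪p, y⟫)) : T p = 0 := by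
  refine eq_zero_of_minty hL hlip fun x => ?_
  have h1 : Tendsto (fun i => ⟪T (u i), u i - x⟫) l (nhds 0) := by
    have h0 : Tendsto (fun i => ‖T (u i)‖ * (R + ‖x‖)) l (nhds 0) := by
      simpa using hT.norm.mul_const (R + ‖x‖)
    refine squeeze_zero_norm (fun i => (norm_inner_le_norm _ _).trans ?_) h0
    gcongr
    exact (norm_sub_le _ _).trans (by gcongr; exact hu i)
  have h2 : Tendsto (fun i => ⟪T (u i) - T x, u i - x⟫) l (nhds (0 - (⟪p, T x⟫ - ⟪x, T x⟫))) := by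
    refine (h1.sub ((hp (T x)).sub_const ⟪x, T x⟫)).congr fun i => ?_
    rw [inner_sub_left (T (u i)), ← inner_sub_left (u i), real_inner_comm (T x)]
  have h3 := ge_of_tendsto' h2 fun i => hmono (u i) x
  rw [← inner_sub_left, real_inner_comm, zero_sub, ← inner_neg_right, neg_sub] at h3
  exact h3

/-- Opial's lemma: a bounded sequence whose distance to each of its weak ultrafilter limits
converges is weakly convergent. -/
theorem exists_weak_limit_of_tendsto_norm_sub
    {H : Type*} [NormedAddCommGroup H] [InnerProductSpace ℝ H] [CompleteSpace H]
    {u : ℕ → H} {R : ℝ} (hu : ∀ n, ‖u n‖ ≤ R) {S : Set H}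
    (hdist : ∀ z ∈ S, ∃ a : ℝ, Tendsto (fun n => ‖u n - z‖ ^ 2) atTop (nhds a))
    (hlim : ∀ (U : Ultrafilter ℕ) (p : H), (U : Filter ℕ) ≤ atTop →
      (∀ y : H, Tendsto (fun n => ⟪u n, y⟫) U (nhds ⟪p, y⟫)) → p ∈ S) :
    ∃ p ∈ S, ∀ y : H, Tendsto (fun n => ⟪u n, y⟫) atTop (nhds ⟪p, y⟫) := by
  obtain ⟨p, hp⟩ := exists_weak_limit_of_ultrafilter hu (Ultrafilter.of atTop)
  have hpS := hlim _ p (Ultrafilter.of_le atTop) hp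
  refine ⟨p, hpS, fun y => (tendsto_iff_ultrafilter _ _ _).mpr fun V hV => ?_⟩
  obtain ⟨q, hq⟩ := exists_weak_limit_of_ultrafilter hu V
  have hqS := hlim V q hV hq
  obtain ⟨a, ha⟩ := hdist p hpS
  obtain ⟨b, hb⟩ := hdist q hqS
  have hc : Tendsto (fun n => ⟪u n, p - q⟫) atTop
      (nhds ((b - a + (‖p‖ ^ 2 - ‖q‖ ^ 2)) / 2)) := by
    refine (((hb.sub ha).add_const (‖p‖ ^ 2 - ‖q‖ ^ 2)).div_const 2).congr fun n => ?_
    rw [norm_sub_sq_real, norm_sub_sq_real, inner_sub_right]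
    ring
  have hpc := tendsto_nhds_unique (hp (p - q)) (hc.mono_left (Ultrafilter.of_le atTop))
  have hqc := tendsto_nhds_unique (hq (p - q)) (hc.mono_left hV)
  have hpq : p = q := by
    rw [← sub_eq_zero, ← inner_self_eq_zero (𝕜 := ℝ), inner_sub_left, hpc, hqc, sub_self]
  exact hpq ▸ hq y

/-- One resolvent step of a monotone operator decreases the squared distance to a zero. -/
theorem norm_sub_sq_add_le_of_resolvent
    {H : Type*} [NormedAddCommGroup H] [InnerProductSpace ℝ H]
    {T : H → H} (hmono : ∀ x y : H, 0 ≤ ⟪T x - T y, x - y⟫)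
    {z : H} (hz : T z = 0) {c γ : ℝ} (hc : 0 ≤ c) (hγ : c ≤ γ)
    {x w : H} (hw : w + γ • T w = x) :
    ‖w - z‖ ^ 2 + c ^ 2 * ‖T w‖ ^ 2 ≤ ‖x - z‖ ^ 2 := by
  have h1 : 0 ≤ ⟪w - z, T w⟫ := by
    simpa [hz, real_inner_comm] using hmono w z
  have h2 : x - z = (w - z) + γ • T w := by
    rw [← hw]
    abel
  rw [h2, norm_add_sq_real, real_inner_smul_right, norm_smul, mul_pow, Real.norm_eq_abs, sq_abs]
  have h3 : c ^ 2 * ‖T w‖ ^ 2 ≤ γ ^ 2 * ‖T w‖ ^ 2 := by gcongr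
  have h4 : 0 ≤ γ * ⟪w - z, T w⟫ := mul_nonneg (hc.trans hγ) h1
  linarith

/-- Weak convergence of the proximal-point (resolvent) iteration for a
monotone Lipschitz operator with a zero (Algorithm 1 without strong
monotonicity). -/
theorem proximal_point_weak_convergence
    {H : Type*} [NormedAddCommGroup H] [InnerProductSpace ℝ H] [CompleteSpace H]
    (L : ℝ) (hL : 0 < L)
    (T : H → H)
    (hmono : ∀ x y : H, 0 ≤ ⟪T x - T y, x - y⟫)
    (hlip : ∀ x y : H, ‖T x - T y‖ ≤ L * ‖x - y‖)
    (hzero : ∃ z : H, T z = 0)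
    (γ : ℕ → ℝ) (γbar : ℝ) (hγbar : 0 < γbar) (hγ : ∀ n, γbar ≤ γ n)
    (ζ : ℕ → H)
    (hrec : ∀ n, ζ (n + 1) + γ n • T (ζ (n + 1)) = ζ n) :
    ∃ ζstar : H, T ζstar = 0 ∧
      ∀ y : H, Tendsto (fun n => ⟪ζ n, y⟫) atTop (nhds ⟪ζstar, y⟫) := by
  have hstep : ∀ z, T z = 0 → ∀ n,
      ‖ζ (n + 1) - z‖ ^ 2 + γbar ^ 2 * ‖T (ζ (n + 1))‖ ^ 2 ≤ ‖ζ n - z‖ ^ 2 :=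
    fun z hz n => norm_sub_sq_add_le_of_resolvent hmono hz hγbar.le (hγ n) (hrec n)
  have hanti : ∀ z, T z = 0 → Antitone fun n => ‖ζ n - z‖ ^ 2 := fun z hz =>
    antitone_nat_of_succ_le fun n =>
      (le_add_of_nonneg_right (by positivity)).trans (hstep z hz n)
  have hdist : ∀ z, T z = 0 → ∃ a : ℝ, Tendsto (fun n => ‖ζ n - z‖ ^ 2) atTop (nhds a) :=
    fun z hz => ⟨_, tendsto_atTop_ciInf (hanti z hz)
      ⟨0, by rintro _ ⟨n, rfl⟩; positivity⟩⟩
  obtain ⟨z, hz⟩ := hzero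
  have hbound : ∀ n, ‖ζ n‖ ≤ ‖ζ 0 - z‖ + ‖z‖ := fun n => by
    have h : ‖ζ n - z‖ ≤ ‖ζ 0 - z‖ :=
      le_of_sq_le_sq (hanti z hz (Nat.zero_le n)) (norm_nonneg _)
    calc ‖ζ n‖ = ‖(ζ n - z) + z‖ := by rw [sub_add_cancel]
      _ ≤ ‖ζ n - z‖ + ‖z‖ := norm_add_le _ _
      _ ≤ ‖ζ 0 - z‖ + ‖z‖ := by gcongr
  have hT : Tendsto (fun n => T (ζ n)) atTop (nhds 0) := by
    obtain ⟨a, ha⟩ := hdist z hz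
    have hdiff : Tendsto (fun n => (‖ζ n - z‖ ^ 2 - ‖ζ (n + 1) - z‖ ^ 2) / γbar ^ 2)
        atTop (nhds 0) := by
      simpa using (ha.sub ((tendsto_add_atTop_iff_nat 1).mpr ha)).div_const (γbar ^ 2)
    have hsq : Tendsto (fun n => ‖T (ζ (n + 1))‖ ^ 2) atTop (nhds 0) := by
      refine squeeze_zero (fun n => by positivity) (fun n => ?_) hdiff
      rw [le_div_iff₀ (by positivity)]
      linarith [hstep z hz n]
    rw [← tendsto_add_atTop_iff_nat 1, tendsto_zero_iff_norm_tendsto_zero]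
    simpa using hsq.sqrt
  exact exists_weak_limit_of_tendsto_norm_sub (S := {z | T z = 0}) hbound hdist
    fun U p hU hp => eq_zero_of_weak_limit hL hmono hlip hbound (hT.mono_left hU) hp
end
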